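/- The conditional copula of the trivariate Clayton copula given its third argument is a bivariate Clayton copula with parameter θ' = θ/(1+θ), independently of the conditioning value: for every θ > 0 and all u₁, u₂, u₃ ∈ (0,1), with θ' = θ/(1+θ), (h_θ(u₁,u₃)^{-θ'} + h_θ(u₂,u₃)^{-θ'} - 1)^{-1/θ'} = u₃^{-(θ+1)}(u₁^{-θ} + u₂^{-θ} + u₃^{-θ} - 2)^{-(1+1/θ)}, where the right-hand side equals the partial derivative ∂C³_θ(u₁,u₂,u₃)/∂u₃ of the trivariate Clayton copula. -/

import Mathlib

open Real

/-- The Clayton h-function h_θ(u,v) = v^{-(θ+1)} (u^{-θ} + v^{-θ} - 1)^{-(1+1/θ)}. -/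
noncomputable def claytonH (θ u v : ℝ) : ℝ :=
  v ^ (-(θ+1)) * (u ^ (-θ) + v ^ (-θ) - 1) ^ (-(1+1/θ))

/-- The `-θ/(1+θ)`-th power linearizes the Clayton h-function in `u ^ (-θ)`. -/
theorem claytonH_rpow {θ u v : ℝ} (hθ : 0 < θ) (hv : 0 < v)
    (h : 0 ≤ u ^ (-θ) + v ^ (-θ) - 1) :
    claytonH θ u v ^ (-(θ/(1+θ))) = v ^ θ * (u ^ (-θ) + v ^ (-θ) - 1) := by
  have hv' : -(θ+1) * -(θ/(1+θ)) = θ := by field_simp; ring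
  have hb : -(1+1/θ) * -(θ/(1+θ)) = 1 := by field_simp; ring
  rw [claytonH, mul_rpow (rpow_nonneg hv.le _) (rpow_nonneg h _), ← rpow_mul hv.le,
    ← rpow_mul h, hv', hb, rpow_one]

/-- The conditional copula of the trivariate Clayton copula given its third
argument is a bivariate Clayton copula with parameter θ' = θ/(1+θ),
independently of the conditioning value; moreover the common value is the
partial derivative ∂C³_θ(u₁,u₂,u₃)/∂u₃ of the trivariate Clayton copula. -/
theorem clayton3_conditional_copula
    (θ : ℝ) (hθ : 0 < θ) (u₁ u₂ u₃ : ℝ)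
    (hu₁ : u₁ ∈ Set.Ioo (0:ℝ) 1) (hu₂ : u₂ ∈ Set.Ioo (0:ℝ) 1)
    (hu₃ : u₃ ∈ Set.Ioo (0:ℝ) 1) :
    ((claytonH θ u₁ u₃) ^ (-(θ/(1+θ))) + (claytonH θ u₂ u₃) ^ (-(θ/(1+θ))) - 1)
        ^ (-1/(θ/(1+θ)))
      = u₃ ^ (-(θ+1)) * (u₁ ^ (-θ) + u₂ ^ (-θ) + u₃ ^ (-θ) - 2) ^ (-(1+1/θ))
    ∧ HasDerivAt (fun w : ℝ => (u₁ ^ (-θ) + u₂ ^ (-θ) + w ^ (-θ) - 2) ^ (-1/θ))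
        (u₃ ^ (-(θ+1)) * (u₁ ^ (-θ) + u₂ ^ (-θ) + u₃ ^ (-θ) - 2) ^ (-(1+1/θ))) u₃ := by
  have one_lt {u : ℝ} (hu : u ∈ Set.Ioo (0:ℝ) 1) : 1 < u ^ (-θ) :=
    one_lt_rpow_of_pos_of_lt_one_of_neg hu.1 hu.2 (neg_lt_zero.mpr hθ)
  have h₁ := one_lt hu₁
  have h₂ := one_lt hu₂
  have h₃ := one_lt hu₃
  have hS : 0 < u₁ ^ (-θ) + u₂ ^ (-θ) + u₃ ^ (-θ) - 2 := by linarith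
  constructor
  · have hinv : u₃ ^ θ * u₃ ^ (-θ) = 1 := by
      rw [← rpow_add hu₃.1, add_neg_cancel, rpow_zero]
    have hsum : u₃ ^ θ * (u₁ ^ (-θ) + u₃ ^ (-θ) - 1) + u₃ ^ θ * (u₂ ^ (-θ) + u₃ ^ (-θ) - 1) - 1
        = u₃ ^ θ * (u₁ ^ (-θ) + u₂ ^ (-θ) + u₃ ^ (-θ) - 2) := by
      linear_combination hinv
    have he : -1/(θ/(1+θ)) = -(1+1/θ) := by field_simp; ring
    have hm : θ * -(1+1/θ) = -(θ+1) := by field_simp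
    rw [claytonH_rpow hθ hu₃.1 (by linarith), claytonH_rpow hθ hu₃.1 (by linarith), hsum, he,
      mul_rpow (rpow_nonneg hu₃.1.le _) hS.le, ← rpow_mul hu₃.1.le, hm]
  · have hd := (((hasDerivAt_rpow_const (p := -θ) (Or.inl hu₃.1.ne')).const_add
      (u₁ ^ (-θ) + u₂ ^ (-θ))).sub_const 2).rpow_const (p := -1/θ) (Or.inl hS.ne')
    convert hd using 1
    rw [show -1/θ - 1 = -(1+1/θ) by ring, show -θ - 1 = -(θ+1) by ring]
    field_simp
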